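/- Let p be a prime, q = p^n, and let d be a positive integer dividing q² − 1 but not dividing q − 1. Then K_d(GL_2(F_q)) = ℚ({ζ_d^r + ζ_d^{qr} : 1 ≤ r ≤ d}). -/

import Mathlib

open CategoryTheory

/-- `zeta N` is the root of unity `e^{2 π i / N}`. -/
noncomputable def zeta (N : ℕ) : ℂ := Complex.exp (2 * Real.pi * Complex.I / N)

/-- `charField G` is the field `K(G)` generated over `ℚ` by all values of
irreducible complex characters of `G`. -/
noncomputable def charField (G : Type) [Group G] : IntermediateField ℚ ℂ :=
  IntermediateField.adjoin ℚ
    {x : ℂ | ∃ V : FDRep ℂ G, Simple V ∧ ∃ g : G, V.character g = x}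

/-- `charFieldAt G d` is the field `K_d(G)` generated over `ℚ` by the values of
irreducible complex characters of `G` at elements of order exactly `d`. -/
noncomputable def charFieldAt (G : Type) [Group G] (d : ℕ) : IntermediateField ℚ ℂ :=
  IntermediateField.adjoin ℚ
    {x : ℂ | ∃ V : FDRep ℂ G, Simple V ∧ ∃ g : G, orderOf g = d ∧ V.character g = x}

lemma IsPrimitiveRoot.pow_eq_pow_iff {ω : ℂ} {d : ℕ} (hω : IsPrimitiveRoot ω d) (hd : d ≠ 0)
    {a b : ℕ} : ω ^ a = ω ^ b ↔ a ≡ b [MOD d] := by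
  obtain ⟨u, rfl⟩ := hω.isUnit hd
  rw [IsPrimitiveRoot.coe_units_iff] at hω
  rw [hω.eq_orderOf, ← pow_eq_pow_iff_modEq]
  norm_cast

/-- The average of the powers of `c • A`; when `A ^ d = 1` and `c ^ d = 1`, it is the projection
onto the eigenspace of `A` for the eigenvalue `c⁻¹`. -/
noncomputable def eigenProj {V : Type*} [AddCommGroup V] [Module ℂ V] (d : ℕ) (c : ℂ)
    (A : Module.End ℂ V) : Module.End ℂ V :=
  (d : ℂ)⁻¹ • ∑ k ∈ Finset.range d, c ^ k • A ^ k

section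
variable {V : Type*} [AddCommGroup V] [Module ℂ V] {d : ℕ} {A : Module.End ℂ V}

lemma mul_eigenProj (hA : A ^ d = 1) {c : ℂ} (hc : c ^ d = 1) :
    (c • A) * eigenProj d c A = eigenProj d c A := by
  have h := Finset.sum_range_succ' (fun k => (c • A) ^ k) d
  rw [Finset.sum_range_succ, smul_pow, hc, hA, pow_zero, one_smul, add_left_inj] at h
  simp only [eigenProj, mul_smul_comm, Finset.mul_sum, ← smul_pow]
  rw [h]
  simp [pow_succ']

lemma eigenProj_isProj (hd : d ≠ 0) (hA : A ^ d = 1) {c : ℂ} (hc : c ^ d = 1) :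
    LinearMap.IsProj (LinearMap.ker (c • A - 1)) (eigenProj d c A) where
  map_mem x := by
    simpa [sub_eq_zero] using LinearMap.congr_fun (mul_eigenProj hA hc) x
  map_id x hx := by
    have h1 : (c • A) x = x := by simpa [sub_eq_zero] using hx
    have h2 (k : ℕ) : ((c • A) ^ k) x = x := by
      induction k with
      | zero => simp
      | succ k ih => rw [pow_succ, Module.End.mul_apply, h1, ih]
    have hd' : (d : ℂ) ≠ 0 := by exact_mod_cast hd
    simp only [eigenProj, ← smul_pow, LinearMap.smul_apply, LinearMap.sum_apply, h2]
    rw [Finset.sum_const, Finset.card_range, ← Nat.cast_smul_eq_nsmul ℂ, smul_smul,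
      inv_mul_cancel₀ hd', one_smul]

lemma pow_eq_sum_eigenProj (hd : d ≠ 0) (hA : A ^ d = 1) {ω : ℂ} (hω : IsPrimitiveRoot ω d)
    (m : ℕ) : A ^ m = ∑ r ∈ Finset.range d, ω ^ (m * r) • eigenProj d ((ω⁻¹) ^ r) A := by
  have hd' : (d : ℂ) ≠ 0 := by exact_mod_cast hd
  have hω0 : ω ≠ 0 := hω.ne_zero hd
  have key (k : ℕ) : ∑ r ∈ Finset.range d, ω ^ (m * r) * ((ω⁻¹) ^ r) ^ k =
      if k ≡ m [MOD d] then (d : ℂ) else 0 := by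
    have h1 (r : ℕ) : ω ^ (m * r) * ((ω⁻¹) ^ r) ^ k = (ω ^ m * (ω ^ k)⁻¹) ^ r := by
      rw [mul_pow, ← pow_mul, inv_pow, ← pow_mul, inv_pow, ← pow_mul, mul_comm r k]
    simp_rw [h1]
    split_ifs with h
    · have : ω ^ m * (ω ^ k)⁻¹ = 1 := by
        rw [mul_inv_eq_one₀ (pow_ne_zero _ hω0), hω.pow_eq_pow_iff hd]
        exact h.symm
      simp [this]
    · have h2 : ω ^ m * (ω ^ k)⁻¹ ≠ 1 := by
        rw [Ne, mul_inv_eq_one₀ (pow_ne_zero _ hω0), hω.pow_eq_pow_iff hd]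
        exact fun h' => h h'.symm
      rw [geom_sum_eq h2, mul_pow, inv_pow, ← pow_mul, ← pow_mul, mul_comm m, mul_comm k,
        pow_mul, pow_mul, hω.pow_eq_one]
      simp
  simp only [eigenProj, Finset.smul_sum]
  rw [Finset.sum_comm]
  have h3 (k : ℕ) : ∑ r ∈ Finset.range d,
      ω ^ (m * r) • (d : ℂ)⁻¹ • ((ω⁻¹) ^ r) ^ k • A ^ k =
      if k ≡ m [MOD d] then A ^ k else 0 := by
    have : ∀ r, ω ^ (m * r) • (d : ℂ)⁻¹ • ((ω⁻¹) ^ r) ^ k • A ^ k =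
      ((d : ℂ)⁻¹ * (ω ^ (m * r) * ((ω⁻¹) ^ r) ^ k)) • A ^ k := by
      intro r; rw [smul_smul, smul_smul]; congr 1; ring
    simp_rw [this, ← Finset.sum_smul, ← Finset.mul_sum, key]
    split_ifs <;> simp [hd']
  simp_rw [h3]
  rw [Finset.sum_eq_single (m % d)]
  · rw [if_pos (Nat.mod_modEq _ _)]
    conv_lhs => rw [← Nat.mod_add_div m d, pow_add, pow_mul, hA, one_pow, mul_one]
  · intro k hk hkm
    rw [if_neg]
    intro h
    exact hkm (by rw [← h, Nat.mod_eq_of_lt (Finset.mem_range.1 hk)])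
  · intro h
    exact absurd (Finset.mem_range.2 (Nat.mod_lt _ (Nat.pos_of_ne_zero hd))) h

lemma trace_pow_eq_sum_finrank [FiniteDimensional ℂ V] (hd : d ≠ 0) (hA : A ^ d = 1) {ω : ℂ}
    (hω : IsPrimitiveRoot ω d) (m : ℕ) :
    LinearMap.trace ℂ V (A ^ m) = ∑ r ∈ Finset.range d, ω ^ (m * r) *
      (Module.finrank ℂ (LinearMap.ker ((ω⁻¹) ^ r • A - 1)) : ℂ) := by
  rw [pow_eq_sum_eigenProj hd hA hω m, map_sum]
  refine Finset.sum_congr rfl fun r _ => ?_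
  rw [map_smul, smul_eq_mul, (eigenProj_isProj hd hA _).trace]
  rw [← pow_mul, mul_comm, pow_mul, inv_pow, hω.pow_eq_one, inv_one, one_pow]

lemma mem_of_trace_eq_trace_pow [FiniteDimensional ℂ V] (hd : d ≠ 0) (hA : A ^ d = 1) {ω : ℂ}
    (hω : IsPrimitiveRoot ω d) {q : ℕ} (hq : LinearMap.trace ℂ V A = LinearMap.trace ℂ V (A ^ q))
    {K : IntermediateField ℚ ℂ} (hK : ∀ r, 1 ≤ r → r ≤ d → ω ^ r + ω ^ (q * r) ∈ K) :
    LinearMap.trace ℂ V A ∈ K := by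
  have hK' : ∀ r ∈ Finset.range d, ω ^ r + ω ^ (q * r) ∈ K := by
    intro r hr
    rcases Nat.eq_zero_or_pos r with rfl | h
    · have := hK d (by omega) le_rfl
      simpa [mul_comm q, pow_mul, hω.pow_eq_one] using this
    · exact hK r h (Finset.mem_range.1 hr).le
  have h2 : LinearMap.trace ℂ V A = 2⁻¹ * (LinearMap.trace ℂ V (A ^ 1) +
      LinearMap.trace ℂ V (A ^ q)) := by
    rw [pow_one, ← hq]; ring
  rw [h2, trace_pow_eq_sum_finrank hd hA hω, trace_pow_eq_sum_finrank hd hA hω,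
    ← Finset.sum_add_distrib]
  refine mul_mem (inv_mem (ofNat_mem K 2)) (sum_mem fun r hr => ?_)
  rw [one_mul, ← add_mul]
  exact mul_mem (hK' r hr) (natCast_mem K _)

end

section
variable {G : Type} [Group G]

lemma character_eq_add_of_isCompl {W : Type} [AddCommGroup W] [Module ℂ W]
    [FiniteDimensional ℂ W] (ρ : Representation ℂ G W) {N N' : Subrepresentation ρ}
    (h : IsCompl N.toSubmodule N'.toSubmodule) (g : G) :
    ρ.character g = N.toRepresentation.character g + N'.toRepresentation.character g := by
  have hi : DirectSum.IsInternal (fun b : Bool => bif b then N.toSubmodule else N'.toSubmodule) := by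
    rw [DirectSum.isInternal_submodule_iff_isCompl (i := true) (j := false) _ (by simp)
      (by ext b; cases b <;> simp)]
    exact h
  have := LinearMap.trace_eq_sum_trace_restrict hi (f := ρ g) (by
    rintro (_ | _)
    · exact N'.apply_mem_toSubmodule g
    · exact N.apply_mem_toSubmodule g)
  rw [Representation.character, this, Fintype.sum_bool]
  rfl

variable [Finite G]

lemma simple_of_isIrreducible {W : Type} [AddCommGroup W] [Module ℂ W] [FiniteDimensional ℂ W]
    (ρ : Representation ℂ G W) [ρ.IsIrreducible] : Simple (FDRep.of ρ) := by
  have := Fintype.ofFinite G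
  have hG : (Nat.card G : ℂ) ≠ 0 := by exact_mod_cast Nat.card_pos.ne'
  have := invertibleOfNonzero hG
  have h := Representation.char_orthonormal ρ ρ
  rw [if_pos ⟨Representation.Equiv.refl ρ⟩, inv_mul_eq_one₀ hG] at h
  exact (FDRep.simple_iff_char_is_norm_one _).2 h.symm

lemma exists_isCompl_toSubmodule {W : Type} [AddCommGroup W] [Module ℂ W]
    (ρ : Representation ℂ G W) (N : Subrepresentation ρ) :
    ∃ N' : Subrepresentation ρ, IsCompl N.toSubmodule N'.toSubmodule := by
  have : NeZero (Nat.card G : ℂ) := ⟨by exact_mod_cast Nat.card_pos.ne'⟩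
  have hs : ρ.IsSemisimpleRepresentation := inferInstance
  obtain ⟨N', h⟩ := ComplementedLattice.exists_isCompl N
  refine ⟨N', ⟨disjoint_iff.2 ?_, codisjoint_iff.2 ?_⟩⟩
  · rw [← Subrepresentation.toSubmodule_inf, h.inf_eq_bot]; rfl
  · rw [← Subrepresentation.toSubmodule_sup, h.sup_eq_top]; rfl

theorem character_mem_of_forall_simple (g : G) {W : Type} [AddCommGroup W] [Module ℂ W]
    [FiniteDimensional ℂ W] (ρ : Representation ℂ G W) (K : IntermediateField ℚ ℂ)
    (hK : ∀ V : FDRep ℂ G, Simple V → V.character g ∈ K) :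
    ρ.character g ∈ K := by
  induction hn : Module.finrank ℂ W using Nat.strong_induction_on generalizing W with
  | _ n ih =>
    by_cases hirr : ρ.IsIrreducible
    · exact hK (FDRep.of ρ) (simple_of_isIrreducible ρ)
    · by_cases hW : Nontrivial W
      · obtain ⟨N, hN⟩ : ∃ N : Subrepresentation ρ, N ≠ ⊥ ∧ N ≠ ⊤ := by
          by_contra! hcon
          have : Nontrivial (Subrepresentation ρ) := by
            refine ⟨⊥, ⊤, fun h => ?_⟩
            exact bot_ne_top (α := Submodule ℂ W) (congrArg Subrepresentation.toSubmodule h)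
          exact hirr { eq_bot_or_eq_top := fun N => or_iff_not_imp_left.2 (hcon N) }
        obtain ⟨N', hc⟩ := exists_isCompl_toSubmodule ρ N
        have hsum := Submodule.finrank_add_eq_of_isCompl hc
        have hpos : 0 < Module.finrank ℂ N.toSubmodule := by
          rw [Nat.pos_iff_ne_zero, Ne, Submodule.finrank_eq_zero]
          exact fun h => hN.1 (Subrepresentation.toSubmodule_injective h)
        have hlt : Module.finrank ℂ N.toSubmodule < Module.finrank ℂ W :=
          Submodule.finrank_lt fun h => hN.2 (Subrepresentation.toSubmodule_injective h)
        rw [character_eq_add_of_isCompl ρ hc]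
        exact add_mem (ih _ (by omega) _ rfl) (ih _ (by omega) _ rfl)
      · rw [not_nontrivial_iff_subsingleton] at hW
        have : ρ g = 0 := Subsingleton.elim _ _
        rw [Representation.character, this, map_zero]
        exact zero_mem K
end

section
variable {G : Type} [Group G]

/-- The representation of `G` on `G → ℂ` by left translation. -/
def leftTranslation (G : Type) [Group G] : Representation ℂ G (G → ℂ) where
  toFun h := LinearMap.funLeft ℂ ℂ fun x => h⁻¹ * x
  map_one' := by ext; simp
  map_mul' a b := by ext; simp [LinearMap.funLeft, mul_assoc]

/-- Right translation by `g` on `G → ℂ`. -/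
def rightTranslation (g : G) : Module.End ℂ (G → ℂ) := LinearMap.funLeft ℂ ℂ fun x => x * g

lemma rightTranslation_pow (g : G) (k : ℕ) :
    rightTranslation g ^ k = rightTranslation (g ^ k) := by
  induction k with
  | zero => ext; simp [rightTranslation]
  | succ k ih =>
    rw [pow_succ, ih]
    ext f x
    simp only [rightTranslation, Module.End.mul_apply, LinearMap.funLeft_apply, pow_succ, mul_assoc]

lemma commute_leftTranslation_rightTranslation (h g : G) :
    Commute (leftTranslation G h) (rightTranslation g) := by
  ext f x
  simp [rightTranslation, leftTranslation, mul_assoc, LinearMap.funLeft]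

lemma trace_funLeft {X : Type*} [Fintype X] (σ : X → X) :
    LinearMap.trace ℂ (X → ℂ) (LinearMap.funLeft ℂ ℂ σ) = Nat.card {x // σ x = x} := by
  classical
  rw [Nat.card_eq_fintype_card, LinearMap.trace_eq_matrix_trace ℂ (Pi.basisFun ℂ X), Matrix.trace]
  simp [LinearMap.funLeft, Pi.single_apply, Fintype.card_subtype]

/-- The functions `f` with `c * f (x * g) = f x`, a representation of `G` induced from a
linear character of the cyclic group generated by `g`. -/
noncomputable def inducedCyclic (g : G) (c : ℂ) : Subrepresentation (leftTranslation G) where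
  toSubmodule := LinearMap.ker (c • rightTranslation g - 1)
  apply_mem_toSubmodule h v hv := by
    have hc : Commute (c • rightTranslation g - 1) (leftTranslation G h) :=
      (((commute_leftTranslation_rightTranslation h g).symm.smul_left c).sub_left
        (Commute.one_left _))
    rw [LinearMap.mem_ker] at hv ⊢
    rw [← Module.End.mul_apply, hc.eq, Module.End.mul_apply, hv, map_zero]

lemma character_inducedCyclic [Finite G] (g h : G) {c : ℂ} (hc : c ^ orderOf g = 1) :
    (inducedCyclic g c).toRepresentation.character h = (orderOf g : ℂ)⁻¹ *
      ∑ k ∈ Finset.range (orderOf g), c ^ k * (Nat.card {x : G // x * g ^ k = h * x} : ℂ) := by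
  have := Fintype.ofFinite G
  have hA : rightTranslation g ^ orderOf g = 1 := by
    rw [rightTranslation_pow, pow_orderOf_eq_one]; ext; simp [rightTranslation]
  have hproj := eigenProj_isProj (orderOf_pos g).ne' hA hc
  set e := eigenProj (orderOf g) c (rightTranslation g) with he
  have hmem : ∀ v, (leftTranslation G h * e) v ∈ (inducedCyclic g c).toSubmodule := fun v =>
    (inducedCyclic g c).apply_mem_toSubmodule h (hproj.map_mem v)
  have h1 : (inducedCyclic g c).toRepresentation h =
      (leftTranslation G h * e).restrict fun v _ => hmem v := by
    ext1 v
    apply Subtype.ext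
    change leftTranslation G h v = leftTranslation G h (e v)
    rw [hproj.map_id v v.2]
  rw [Representation.character, h1, LinearMap.trace_restrict_eq_of_forall_mem _ _ hmem, he]
  simp only [eigenProj, mul_smul_comm, Finset.mul_sum, map_smul, map_sum, smul_eq_mul,
    rightTranslation_pow]
  refine Finset.sum_congr rfl fun k _ => ?_
  have h2 : leftTranslation G h * rightTranslation (g ^ k) =
      LinearMap.funLeft ℂ ℂ fun x => h⁻¹ * x * g ^ k := by
    ext f x; simp [rightTranslation, leftTranslation, LinearMap.funLeft]
  rw [h2, trace_funLeft]
  congr 3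
  refine Nat.card_congr (Equiv.subtypeEquivRight fun x => ?_)
  rw [mul_assoc, inv_mul_eq_iff_eq_mul]

lemma card_intertwiners_eq_of_isConj [Finite G] {a b h : G} (hab : IsConj a b) :
    Nat.card {x : G // x * a = h * x} = Nat.card {x : G // x * b = h * x} := by
  obtain ⟨c, rfl⟩ := isConj_iff.1 hab
  refine Nat.card_congr ((Equiv.mulRight c⁻¹).subtypeEquiv fun x => ?_)
  have hx : x * c⁻¹ * (c * a * c⁻¹) = x * a * c⁻¹ := by group
  rw [Equiv.coe_mulRight, hx, ← mul_assoc h, mul_left_inj]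

lemma character_inducedCyclic_self [Finite G] (g : G) {c : ℂ} (hc : c ^ orderOf g = 1) {q : ℕ}
    (hq : ¬ q ≡ 1 [MOD orderOf g]) (hconj : IsConj g (g ^ q))
    (h : ∀ k, IsConj g (g ^ k) → g ^ k = g ∨ g ^ k = g ^ q) :
    (inducedCyclic g c).toRepresentation.character g = (orderOf g : ℂ)⁻¹ *
      (Nat.card {x : G // x * g = g * x} : ℂ) * (c + c ^ q) := by
  have hd : 0 < orderOf g := orderOf_pos g
  have hd1 : 1 < orderOf g := by
    by_contra! h1
    exact hq (by rw [show orderOf g = 1 by omega]; exact Nat.modEq_one)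
  have hqm : g ^ (q % orderOf g) = g ^ q := pow_mod_orderOf g q
  have hne : 1 ≠ q % orderOf g := by
    intro h1
    exact hq (by rw [Nat.ModEq, ← h1, Nat.mod_eq_of_lt hd1])
  rw [character_inducedCyclic g g hc, mul_assoc]
  congr 1
  rw [← Finset.sum_subset (s₁ := {1, q % orderOf g}), Finset.sum_pair hne, hqm,
    ← card_intertwiners_eq_of_isConj hconj, pow_one, pow_one, mul_add, mul_comm c,
    mul_comm (c ^ _)]
  · congr 2
    conv_rhs => rw [← Nat.mod_add_div q (orderOf g), pow_add, pow_mul, hc, one_pow, mul_one]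
  · intro k
    simp only [Finset.mem_insert, Finset.mem_singleton, Finset.mem_range]
    rintro (rfl | rfl)
    exacts [hd1, Nat.mod_lt _ hd]
  · intro k hk hk'
    simp only [Finset.mem_insert, Finset.mem_singleton, Finset.mem_range, not_or] at hk hk'
    have : IsEmpty {x : G // x * g ^ k = g * x} := by
      refine ⟨fun ⟨x, hx⟩ => ?_⟩
      rcases h k (IsConj.symm (isConj_iff.2 ⟨x, by rw [hx, mul_inv_cancel_right]⟩)) with h1 | h1
      · refine hk'.1 (pow_injOn_Iio_orderOf hk hd1 ?_)
        simpa using h1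
      · refine hk'.2 (pow_injOn_Iio_orderOf hk (Nat.mod_lt _ hd) ?_)
        simpa [hqm] using h1
    simp
end

section
variable {F : Type} [Field F]

lemma exists_mul_companion (M : Matrix (Fin 2) (Fin 2) F) (hM : ∀ c : F, M ≠ Matrix.scalar _ c) :
    ∃ P : GL (Fin 2) F, M * P.1 = P.1 * !![0, -M.det; 1, M.trace] := by
  obtain ⟨u, v, huv⟩ : ∃ u v : F,
      u * (M 1 0 * u + M 1 1 * v) - (M 0 0 * u + M 0 1 * v) * v ≠ 0 := by
    by_contra! hcon
    have h1 := hcon 1 0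
    have h2 := hcon 0 1
    have h3 := hcon 1 1
    simp only [mul_one, mul_zero, add_zero, zero_add, one_mul, sub_zero, zero_sub, neg_eq_zero,
      zero_mul] at h1 h2
    apply hM (M 0 0)
    ext i j
    fin_cases i <;> fin_cases j <;> simp_all
    linear_combination h3
  have hdet : (!![u, M 0 0 * u + M 0 1 * v; v, M 1 0 * u + M 1 1 * v]).det ≠ 0 := by
    rw [Matrix.det_fin_two_of]; exact huv
  refine ⟨Matrix.GeneralLinearGroup.mkOfDetNeZero _ hdet, ?_⟩
  simp only [Matrix.GeneralLinearGroup.mkOfDetNeZero, Matrix.det_fin_two, Matrix.trace_fin_two]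
  ext i j
  fin_cases i <;> fin_cases j <;>
    simp [Matrix.mul_apply, Fin.sum_univ_two] <;> ring

lemma isConj_of_trace_eq_of_det_eq {g h : GL (Fin 2) F} (hg : ∀ c : F, g.1 ≠ Matrix.scalar _ c)
    (hh : ∀ c : F, h.1 ≠ Matrix.scalar _ c) (htr : g.1.trace = h.1.trace)
    (hdet : g.1.det = h.1.det) : IsConj g h := by
  obtain ⟨P, hP⟩ := exists_mul_companion g.1 hg
  obtain ⟨Q, hQ⟩ := exists_mul_companion h.1 hh
  rw [htr, hdet] at hP
  refine isConj_iff.2 ⟨Q * P⁻¹, ?_⟩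
  have hP' : (P⁻¹ * g * P).1 = !![0, -h.1.det; 1, h.1.trace] := by
    rw [mul_assoc, Units.val_mul, Units.val_mul, hP, ← mul_assoc, ← Units.val_mul, inv_mul_cancel,
      Units.val_one, one_mul]
  rw [← hP', ← Units.val_mul, ← Units.val_mul, Units.val_inj] at hQ
  rw [mul_inv_rev, inv_inv, ← mul_assoc, mul_inv_eq_iff_eq_mul, hQ]
  simp only [mul_assoc]

lemma sq_sub_trace_mul_add_det (M : Matrix (Fin 2) (Fin 2) F) :
    M ^ 2 - M.trace • M + M.det • (1 : Matrix (Fin 2) (Fin 2) F) = 0 := by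
  have := Matrix.aeval_self_charpoly M
  rw [Matrix.charpoly_fin_two] at this
  simpa [Algebra.smul_def] using this

variable [Fintype F]

lemma orderOf_dvd_card_sub_one_of_scalar {g : GL (Fin 2) F} {c : F}
    (hg : g.1 = Matrix.scalar _ c) : orderOf g ∣ Fintype.card F - 1 := by
  have hc : c ≠ 0 := by
    rintro rfl
    have := Matrix.GeneralLinearGroup.det_ne_zero g
    simp [hg] at this
  rw [orderOf_dvd_iff_pow_eq_one, ← Units.val_inj, Units.val_pow_eq_pow_val, hg, ← map_pow,
    FiniteField.pow_card_sub_one_eq_one c hc, map_one, Units.val_one]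

theorem isConj_pow_card {g : GL (Fin 2) F} (h1 : orderOf g ∣ Fintype.card F ^ 2 - 1)
    (h2 : ¬ orderOf g ∣ Fintype.card F - 1) : IsConj g (g ^ Fintype.card F) := by
  have hg : ∀ c : F, g.1 ≠ Matrix.scalar _ c := fun c hc =>
    h2 (orderOf_dvd_card_sub_one_of_scalar hc)
  have hsq : (g ^ Fintype.card F) ^ Fintype.card F = g := by
    have := orderOf_dvd_iff_pow_eq_one.1 h1
    rw [← pow_mul, ← sq, ← Nat.sub_add_cancel (Nat.one_le_pow 2 _ Fintype.card_pos), pow_succ,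
      this, one_mul]
  have hchar := FiniteField.Matrix.charpoly_pow_card g.1
  have hdet : (g ^ Fintype.card F).1.det = g.1.det := by
    rw [Units.val_pow_eq_pow_val, Matrix.det_eq_sign_charpoly_coeff, hchar,
      ← Matrix.det_eq_sign_charpoly_coeff]
  have htr : (g ^ Fintype.card F).1.trace = g.1.trace := by
    rw [Units.val_pow_eq_pow_val, Matrix.trace_eq_neg_charpoly_coeff, hchar,
      ← Matrix.trace_eq_neg_charpoly_coeff]
  refine isConj_of_trace_eq_of_det_eq hg (fun c hc => hg (c ^ Fintype.card F) ?_) htr.symm hdet.symm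
  rw [map_pow, ← hc, ← Units.val_pow_eq_pow_val, hsq]

theorem pow_eq_or_of_isConj {K : Type*} [Field K] [Algebra F K]
    (φ : K →ₐ[F] Matrix (Fin 2) (Fin 2) F) {g : GL (Fin 2) F} {α : K} (hα : φ α = g.1)
    (h2 : ¬ orderOf g ∣ Fintype.card F - 1) {k : ℕ} (hk : IsConj g (g ^ k)) :
    g ^ k = g ∨ g ^ k = g ^ Fintype.card F := by
  have hφ : Function.Injective φ := φ.toRingHom.injective
  set t := g.1.trace
  set δ := g.1.det
  have hroot {x : K} {y : GL (Fin 2) F} (hx : φ x = y.1) (hy : IsConj g y) :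
      x ^ 2 - algebraMap F K t * x + algebraMap F K δ = 0 := by
    obtain ⟨c, rfl⟩ := isConj_iff.1 hy
    have := sq_sub_trace_mul_add_det (c * g * c⁻¹).1
    have htr : (c * g * c⁻¹).1.trace = t := by
      rw [Units.val_mul, Matrix.trace_mul_comm, ← Units.val_mul, inv_mul_cancel_left]
    have hdet : (c * g * c⁻¹).1.det = δ := by
      rw [Units.val_mul, Matrix.det_mul_comm, ← Units.val_mul, inv_mul_cancel_left]
    rw [htr, hdet, ← hx] at this
    apply hφ
    simpa [Algebra.smul_def] using this
  have hpow (m : ℕ) : φ (α ^ m) = (g ^ m).1 := by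
    rw [map_pow, hα, Units.val_pow_eq_pow_val]
  have e1 := hroot hα (IsConj.refl g)
  have e2 := hroot (hpow k) hk
  have e3 : (α ^ Fintype.card F) ^ 2 - algebraMap F K t * α ^ Fintype.card F
      + algebraMap F K δ = 0 := by
    have := congrArg (FiniteField.frobeniusAlgHom F K) e1
    simpa only [map_add, map_sub, map_mul, map_pow, AlgHom.commutes, map_zero,
      FiniteField.frobeniusAlgHom_apply] using this
  have hne : α ^ Fintype.card F - α ≠ 0 := by
    intro h0
    apply h2
    have : g ^ Fintype.card F = g := by
      rw [← Units.val_inj, ← hpow, sub_eq_zero.1 h0, hα]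
    rw [orderOf_dvd_iff_pow_eq_one]
    rw [← Nat.sub_add_cancel (Fintype.card_pos (α := F)), pow_succ] at this
    simpa using this
  have ht : algebraMap F K t = α + α ^ Fintype.card F := by
    refine mul_left_cancel₀ hne ?_
    linear_combination e1 - e3
  have h0 : (α ^ k - α) * (α ^ k - α ^ Fintype.card F) = 0 := by
    linear_combination e2 - e1 + (α ^ k - α) * ht
  rcases mul_eq_zero.1 h0 with h | h
  · left; rw [← Units.val_inj, ← hpow, sub_eq_zero.1 h, hα]
  · right; rw [← Units.val_inj, ← hpow, sub_eq_zero.1 h, hpow]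

theorem exists_orderOf_eq_of_dvd_card_sq_sub_one {d : ℕ} (hd : d ∣ Fintype.card F ^ 2 - 1) :
    ∃ (K : Type) (_ : Field K) (_ : Algebra F K) (φ : K →ₐ[F] Matrix (Fin 2) (Fin 2) F)
      (g : GL (Fin 2) F) (α : K), φ α = g.1 ∧ orderOf g = d := by
  obtain ⟨p, _⟩ := CharP.exists F
  have : Fact p.Prime := ⟨CharP.char_is_prime F p⟩
  let K := FiniteField.Extension F p 2
  let b : Module.Basis (Fin 2) F K :=
    Module.finBasisOfFinrankEq F K (FiniteField.finrank_extension F p 2)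
  let φ : K →ₐ[F] Matrix (Fin 2) (Fin 2) F := Algebra.leftMulMatrix b
  have hφ : Function.Injective (Units.map (φ : K →* Matrix (Fin 2) (Fin 2) F)) :=
    Units.map_injective (Algebra.leftMulMatrix_injective b)
  have hcard : Nat.card Kˣ = Fintype.card F ^ 2 - 1 := by
    rw [Nat.card_units, FiniteField.natCard_extension, Nat.card_eq_fintype_card]
  obtain ⟨u, hu⟩ := IsCyclic.exists_generator (α := Kˣ)
  have hou : orderOf u = Fintype.card F ^ 2 - 1 := by
    rw [← hcard, orderOf_eq_card_of_forall_mem_zpowers hu]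
  have hpos : 0 < Fintype.card F ^ 2 - 1 := hou ▸ orderOf_pos u
  obtain ⟨m, hm⟩ := hd
  have hm0 : m ≠ 0 := by rintro rfl; omega
  refine ⟨K, inferInstance, inferInstance, φ, Units.map (φ : K →* _) (u ^ m), (u ^ m : Kˣ), rfl, ?_⟩
  rw [orderOf_injective _ hφ, orderOf_pow_of_dvd hm0 (by rw [hou, hm]; exact dvd_mul_left _ _),
    hou, hm, Nat.mul_div_cancel _ (Nat.pos_of_ne_zero hm0)]
end

/-- For `d ∣ q² − 1` with `d ∤ q − 1`,
`K_d(GL_2(F_q)) = ℚ({ζ_d^r + ζ_d^{qr} : 1 ≤ r ≤ d})`. -/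
theorem statement11 (p n q d : ℕ) (hp : p.Prime) (hn : 1 ≤ n) (hq : q = p ^ n)
    (hd : d ∣ q ^ 2 - 1) (hd' : ¬ d ∣ q - 1)
    (F : Type) [Field F] [Fintype F] (hF : Fintype.card F = q) :
    charFieldAt (GL (Fin 2) F) d =
      IntermediateField.adjoin ℚ
        {x : ℂ | ∃ r : ℕ, 1 ≤ r ∧ r ≤ d ∧ x = zeta d ^ r + zeta d ^ (q * r)} := by
  have hq1 : 1 < q := hF ▸ Fintype.one_lt_card
  have hd0 : d ≠ 0 := by
    rintro rfl
    have : 1 < q ^ 2 := Nat.one_lt_pow two_ne_zero hq1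
    have := zero_dvd_iff.1 hd
    omega
  have hζ : IsPrimitiveRoot (zeta d) d := Complex.isPrimitiveRoot_exp d hd0
  apply le_antisymm
  · rw [charFieldAt, IntermediateField.adjoin_le_iff]
    rintro _ ⟨V, -, g, hg, rfl⟩
    rw [SetLike.mem_coe]
    have hconj : IsConj g (g ^ q) := by
      subst hF hg
      exact isConj_pow_card hd hd'
    have hχ : V.character (g ^ q) = V.character g := by
      obtain ⟨c, hc⟩ := isConj_iff.1 hconj
      rw [← hc, FDRep.char_conj]
    refine mem_of_trace_eq_trace_pow (A := V.ρ g) hd0 ?_ hζ ?_ fun r h1 hr =>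
      IntermediateField.subset_adjoin ℚ _ ⟨r, h1, hr, rfl⟩
    · rw [← map_pow, ← hg, pow_orderOf_eq_one, map_one]
    · rw [← map_pow]; exact hχ.symm
  · rw [IntermediateField.adjoin_le_iff]
    rintro _ ⟨r, -, -, rfl⟩
    rw [SetLike.mem_coe]
    obtain ⟨K, _, _, φ, g, α, hα, hg⟩ :=
      exists_orderOf_eq_of_dvd_card_sq_sub_one (F := F) (hF ▸ hd)
    have hc : (zeta d ^ r) ^ orderOf g = 1 := by
      rw [hg, ← pow_mul, mul_comm, pow_mul, hζ.pow_eq_one, one_pow]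
    have hg2 : ¬ orderOf g ∣ Fintype.card F - 1 := by rwa [hg, hF]
    have hmem := character_mem_of_forall_simple g
      (inducedCyclic g (zeta d ^ r)).toRepresentation (charFieldAt (GL (Fin 2) F) d)
      fun V hV => IntermediateField.subset_adjoin ℚ _ ⟨V, hV, g, hg, rfl⟩
    have hq2 : ¬ Fintype.card F ≡ 1 [MOD orderOf g] := fun h =>
      hg2 ((Nat.modEq_iff_dvd' Fintype.card_pos).1 h.symm)
    rw [character_inducedCyclic_self g hc hq2
      (isConj_pow_card (by rwa [hg, hF]) hg2) (fun k => pow_eq_or_of_isConj φ hα hg2)] at hmem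
    set N := Nat.card {x // x * g = g * x}
    have hN : (N : ℂ) ≠ 0 := by
      have : Nonempty {x // x * g = g * x} := ⟨1, by simp⟩
      exact_mod_cast Nat.card_pos.ne'
    have ho : (orderOf g : ℂ) ≠ 0 := by exact_mod_cast (orderOf_pos g).ne'
    have := mul_mem (mul_mem (natCast_mem _ (orderOf g)) (inv_mem (natCast_mem _ N))) hmem
    convert this using 1
    rw [hF, ← pow_mul, mul_comm r q]
    field_simp
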